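/- Let s > 3/2, let m ≥ 2 be an integer, and let δ, δ₀ ∈ ℝ satisfy δ₀/(m−1) − 3/2 ≤ δ. Then there is a constant C, independent of u, such that for every u ∈ H_{s,δ}, the power u^m belongs to H_{s,δ+δ₀} and ‖u^m‖_{H_{s,δ+δ₀}} ≤ C ‖u‖_{H_{s,δ}}^m. -/

import Mathlib

open MeasureTheory Real Set
open scoped FourierTransform ENNReal NNReal

noncomputable section

abbrev E3 : Type := EuclideanSpace ℝ (Fin 3)

/-- A dyadic partition of unity on ℝ³ as in the paper: `ψ j ∈ C_0^∞`, nonnegative,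
`supp ψ₀ ⊆ {|x| ≤ 2}`, `ψ₀ = 1` on `{|x| ≤ 1}`, for `j ≥ 1`
`supp ψ_j ⊆ {2^(j-2) ≤ |x| ≤ 2^(j+1)}`, `ψ_j = 1` on `{2^(j-1) ≤ |x| ≤ 2^j}`, and
`|∂^α ψ_j| ≤ C_α 2^(-|α| j)` with `C_α` independent of `j`. -/
structure DyadicPartition where
  ψ : ℕ → E3 → ℝ
  smooth : ∀ j, ContDiff ℝ (⊤ : ℕ∞) (ψ j)
  nonneg : ∀ j x, 0 ≤ ψ j x
  compSupp : ∀ j, HasCompactSupport (ψ j)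
  supp_zero : ∀ x : E3, ψ 0 x ≠ 0 → ‖x‖ ≤ 2
  one_zero : ∀ x : E3, ‖x‖ ≤ 1 → ψ 0 x = 1
  supp_succ : ∀ j : ℕ, 1 ≤ j → ∀ x : E3, ψ j x ≠ 0 →
    (2:ℝ) ^ ((j:ℤ) - 2) ≤ ‖x‖ ∧ ‖x‖ ≤ (2:ℝ) ^ ((j:ℤ) + 1)
  one_succ : ∀ j : ℕ, 1 ≤ j → ∀ x : E3,
    (2:ℝ) ^ ((j:ℤ) - 1) ≤ ‖x‖ → ‖x‖ ≤ (2:ℝ) ^ (j:ℤ) → ψ j x = 1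
  deriv_bound : ∀ n : ℕ, ∃ C : ℝ, ∀ (j : ℕ) (x : E3),
    ‖iteratedFDeriv ℝ n (ψ j) x‖ ≤ C * (2:ℝ) ^ (-(n:ℤ) * (j:ℤ))

/-- The squared `H^s` norm `∫ (1+|ξ|²)^s |𝓕f(ξ)|² dξ` of a complex-valued function. -/
def HsNormSq (s : ℝ) (f : E3 → ℂ) : ℝ≥0∞ :=
  ∫⁻ ξ : E3, ENNReal.ofReal ((1 + ‖ξ‖ ^ 2) ^ s) * (‖𝓕 f ξ‖₊ : ℝ≥0∞) ^ 2

/-- The squared weighted Sobolev norm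
`‖u‖²_{H_{s,δ}} = Σ_j 2^{(3/2+δ)2j} ‖(ψ_j u)_{2^j}‖²_{H^s}`,
where `(ψ_j u)_{2^j}(x) = ψ_j(2^j x) u(2^j x)`. -/
def HwNormSq (P : DyadicPartition) (s δ : ℝ) (u : E3 → ℝ) : ℝ≥0∞ :=
  ∑' j : ℕ, ENNReal.ofReal ((2:ℝ) ^ ((3 + 2 * δ) * (j:ℝ))) *
    HsNormSq s (fun x : E3 =>
      ((P.ψ j (((2:ℝ) ^ (j:ℕ)) • x) * u (((2:ℝ) ^ (j:ℕ)) • x) : ℝ) : ℂ))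

/-- Membership in the weighted Sobolev space `H_{s,δ}` (for functions). -/
def MemH (P : DyadicPartition) (s δ : ℝ) (u : E3 → ℝ) : Prop :=
  LocallyIntegrable u volume ∧ HwNormSq P s δ u < ⊤

/-- The weighted Sobolev norm `‖u‖_{H_{s,δ}}`. -/
def Hnorm (P : DyadicPartition) (s δ : ℝ) (u : E3 → ℝ) : ℝ :=
  Real.sqrt (HwNormSq P s δ u).toReal

/-- The squared weighted `L²_δ` norm `∫ (1+|x|)^{2δ} |u(x)|² dx`. -/
def L2wNormSq (δ : ℝ) (u : E3 → ℝ) : ℝ≥0∞ :=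
  ∫⁻ x : E3, ENNReal.ofReal ((1 + ‖x‖) ^ (2 * δ)) * (‖u x‖₊ : ℝ≥0∞) ^ 2

/-- The weighted `L²_δ` norm. -/
def L2wNorm (δ : ℝ) (u : E3 → ℝ) : ℝ :=
  Real.sqrt (L2wNormSq δ u).toReal

/-- Membership in `L²_δ`. -/
def MemL2w (δ : ℝ) (u : E3 → ℝ) : Prop :=
  AEStronglyMeasurable u volume ∧ L2wNormSq δ u < ⊤

/-- The partial derivative `∂_a f (x)`. -/
def pd (f : E3 → ℝ) (a : Fin 3) (x : E3) : ℝ :=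
  fderiv ℝ f x (EuclideanSpace.single a 1)

/-! ### Inequalities for Lebesgue integrals -/

/-- The Cauchy–Schwarz inequality for the lower Lebesgue integral. -/
lemma sq_lintegral_mul_le {f g : E3 → ℝ≥0∞} (hf : Measurable f) (hg : Measurable g) :
    (∫⁻ x, f x * g x) ^ 2 ≤ (∫⁻ x, f x ^ 2) * ∫⁻ x, g x ^ 2 := by
  have h := ENNReal.lintegral_mul_le_Lp_mul_Lq volume Real.HolderConjugate.two_two
    hf.aemeasurable hg.aemeasurable
  calc (∫⁻ x, f x * g x) ^ 2
      ≤ ((∫⁻ x, f x ^ (2 : ℝ)) ^ (1 / (2 : ℝ)) * (∫⁻ x, g x ^ (2 : ℝ)) ^ (1 / (2 : ℝ))) ^ 2 := by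
        gcongr
        exact h
    _ = _ := by
        rw [mul_pow, ← ENNReal.rpow_natCast, ← ENNReal.rpow_natCast, ← ENNReal.rpow_mul,
          ← ENNReal.rpow_mul]
        norm_num

/-- Young's inequality for the convolution of a square integrable with an integrable function. -/
lemma lintegral_sq_convolution_le {a b : E3 → ℝ≥0∞} (ha : Measurable a) (hb : Measurable b) :
    ∫⁻ ξ, (∫⁻ η, a (ξ - η) * b η) ^ 2 ≤ (∫⁻ η, b η) ^ 2 * ∫⁻ ξ, a ξ ^ 2 := by
  have hsq : ∀ t : ℝ≥0∞, t ^ (1 / 2 : ℝ) * t ^ (1 / 2 : ℝ) = t := fun t => by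
    rw [← ENNReal.rpow_add_of_nonneg _ _ (by norm_num) (by norm_num)]
    norm_num
  have hsq' : ∀ t : ℝ≥0∞, (t ^ (1 / 2 : ℝ)) ^ 2 = t := fun t => by rw [pow_two, hsq]
  have key : ∀ ξ, (∫⁻ η, a (ξ - η) * b η) ^ 2 ≤
      (∫⁻ η, a (ξ - η) ^ 2 * b η) * ∫⁻ η, b η := fun ξ => by
    have h := sq_lintegral_mul_le (f := fun η => a (ξ - η) * b η ^ (1 / 2 : ℝ))
      (g := fun η => b η ^ (1 / 2 : ℝ)) (by fun_prop) (by fun_prop)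
    simpa only [mul_pow, mul_assoc, hsq, hsq'] using h
  have hm : Measurable fun p : E3 × E3 => a (p.1 - p.2) ^ 2 * b p.2 := by fun_prop
  calc ∫⁻ ξ, (∫⁻ η, a (ξ - η) * b η) ^ 2
      ≤ ∫⁻ ξ, (∫⁻ η, a (ξ - η) ^ 2 * b η) * ∫⁻ η, b η := lintegral_mono key
    _ = (∫⁻ ξ, ∫⁻ η, a (ξ - η) ^ 2 * b η) * ∫⁻ η, b η :=
        lintegral_mul_const _ hm.lintegral_prod_right'
    _ = (∫⁻ η, ∫⁻ ξ, a (ξ - η) ^ 2 * b η) * ∫⁻ η, b η := by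
        rw [lintegral_lintegral_swap hm.aemeasurable]
    _ = (∫⁻ η, (∫⁻ ξ, a ξ ^ 2) * b η) * ∫⁻ η, b η := by
        congr 2 with η
        rw [lintegral_mul_const _ (by fun_prop),
          lintegral_sub_right_eq_self (fun ξ => a ξ ^ 2) η]
    _ = _ := by
        rw [lintegral_const_mul _ hb]
        ring

/-! ### The Fourier transform -/

lemma continuous_fourier {f : E3 → ℂ} (hf : Integrable f) : Continuous (𝓕 f) :=
  VectorFourier.fourierIntegral_continuous Real.continuous_fourierChar
    continuous_inner hf

lemma integral_fourier_mul_eq {f g : E3 → ℂ} (hf : Integrable f) (hg : Integrable g) :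
    ∫ ξ, 𝓕 f ξ * g ξ = ∫ x, f x * 𝓕 g x := by
  simpa using! VectorFourier.integral_fourierIntegral_smul_eq_flip (L := innerₗ E3)
    Real.continuous_fourierChar continuous_inner hf hg

lemma integral_mul_fourierInv_eq {f g : E3 → ℂ} (hf : Integrable f) (hg : Integrable g) :
    ∫ x, f x * 𝓕⁻ g x = ∫ ξ, 𝓕⁻ f ξ * g ξ := by
  have h := integral_fourier_mul_eq hf hg.comp_neg
  have h₁ : ∀ x, 𝓕⁻ g x = 𝓕 (fun y => g (-y)) x := fun x => by
    rw [Real.fourierInv_eq_fourier_comp_neg]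
  simp only [h₁, ← h, Real.fourierInv_eq_fourier_neg f]
  rw [← integral_neg_eq_self (fun ξ => 𝓕 f ξ * g (-ξ))]
  simp

lemma continuous_fourierInv {f : E3 → ℂ} (hf : Integrable f) : Continuous (𝓕⁻ f) := by
  rw [Real.fourierInv_eq_fourier_comp_neg]
  exact continuous_fourier hf.comp_neg

/-- Fourier inversion almost everywhere. -/
lemma fourierInv_fourier_ae_eq {f : E3 → ℂ} (hf : Integrable f) (hf' : Integrable (𝓕 f)) :
    f =ᵐ[volume] 𝓕⁻ (𝓕 f) := by
  refine ae_eq_of_integral_contDiff_smul_eq hf.locallyIntegrable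
    (continuous_fourierInv hf').locallyIntegrable fun g hg hgc => ?_
  let φ : SchwartzMap E3 ℂ := (hgc.comp_left (g := ((↑) : ℝ → ℂ)) (by simp)).toSchwartzMap
    (Complex.ofRealCLM.contDiff.comp hg)
  have hφ : ∀ x, φ x = (g x : ℂ) := fun x => rfl
  have hinv : 𝓕 (𝓕⁻ (φ : E3 → ℂ)) = φ := by
    rw [← SchwartzMap.fourierInv_coe, ← SchwartzMap.fourier_coe]
    simp
  have hint : Integrable (𝓕⁻ (φ : E3 → ℂ)) := by
    rw [← SchwartzMap.fourierInv_coe]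
    exact SchwartzMap.integrable _
  calc ∫ x, g x • f x = ∫ x, f x * 𝓕 (𝓕⁻ (φ : E3 → ℂ)) x := by
        simp [hinv, hφ, mul_comm]
    _ = ∫ ξ, 𝓕 f ξ * 𝓕⁻ (φ : E3 → ℂ) ξ := (integral_fourier_mul_eq hf hint).symm
    _ = ∫ x, 𝓕⁻ (𝓕 f) x * φ x := integral_mul_fourierInv_eq hf' φ.integrable
    _ = _ := by simp [hφ, mul_comm]

lemma norm_fourierInv_le {f : E3 → ℂ} (x : E3) : ‖𝓕⁻ f x‖ ≤ ∫ ξ, ‖f ξ‖ := by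
  rw [Real.fourierInv_eq_fourier_neg]
  exact VectorFourier.norm_fourierIntegral_le_integral_norm _ _ _ _ _

lemma integrable_mul_of_integrable_fourier {f g : E3 → ℂ} (hf : Integrable f)
    (hg : Integrable g) (hg' : Integrable (𝓕 g)) : Integrable fun x => f x * g x := by
  refine hf.mul_bdd (c := ∫ ξ, ‖𝓕 g ξ‖) hg.1 ?_
  filter_upwards [fourierInv_fourier_ae_eq hg hg'] with x hx
  rw [hx]
  exact norm_fourierInv_le x

/-- The Fourier transform of a product is the convolution of the Fourier transforms. -/
lemma fourier_mul_eq {f g : E3 → ℂ} (hf : Integrable f) (hg : Integrable g)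
    (hg' : Integrable (𝓕 g)) (ξ : E3) :
    𝓕 (fun x => f x * g x) ξ = ∫ η, 𝓕 f (ξ - η) * 𝓕 g η := by
  have hint : Integrable fun x => 𝐞 (-inner ℝ x ξ) • f x :=
    (Real.fourierIntegral_convergent_iff ξ).2 hf
  calc 𝓕 (fun x => f x * g x) ξ
      = ∫ x, (𝐞 (-inner ℝ x ξ) • f x) * 𝓕⁻ (𝓕 g) x := by
        rw [Real.fourier_eq]
        refine integral_congr_ae ?_
        filter_upwards [fourierInv_fourier_ae_eq hg hg'] with x hx
        rw [← hx, smul_mul_assoc]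
    _ = ∫ η, 𝓕⁻ (fun x => 𝐞 (-inner ℝ x ξ) • f x) η * 𝓕 g η :=
        integral_mul_fourierInv_eq hint hg'
    _ = _ := by
        congr 1 with η
        congr 1
        rw [Real.fourierInv_eq, Real.fourier_eq]
        congr 1 with x
        rw [smul_smul, ← AddChar.map_add_eq_mul, inner_sub_right]
        congr 2
        ring

/-! ### The Sobolev space of order `s > 3/2` is an algebra -/

/-- The weight `(1 + |ξ|²)^(s/2)`. -/
def sobolevWeight (s : ℝ) (ξ : E3) : ℝ≥0∞ := ENNReal.ofReal ((1 + ‖ξ‖ ^ 2) ^ (s / 2))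

lemma measurable_sobolevWeight (s : ℝ) : Measurable (sobolevWeight s) := by
  unfold sobolevWeight
  fun_prop

lemma sobolevWeight_sq (s : ℝ) (ξ : E3) :
    sobolevWeight s ξ ^ 2 = ENNReal.ofReal ((1 + ‖ξ‖ ^ 2) ^ s) := by
  rw [sobolevWeight, ← ENNReal.ofReal_pow (by positivity), ← Real.rpow_natCast,
    ← Real.rpow_mul (by positivity)]
  norm_num

lemma sobolevWeight_le_add {s : ℝ} (hs : 0 ≤ s) (ξ η : E3) :
    sobolevWeight s ξ ≤
      ENNReal.ofReal (4 ^ (s / 2)) * (sobolevWeight s (ξ - η) + sobolevWeight s η) := by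
  unfold sobolevWeight
  rw [← ENNReal.ofReal_add (by positivity) (by positivity),
    ← ENNReal.ofReal_mul (by positivity)]
  refine ENNReal.ofReal_le_ofReal ?_
  have hξ : ‖ξ‖ ≤ ‖ξ - η‖ + ‖η‖ := by simpa using norm_add_le (ξ - η) η
  have h0 := norm_nonneg ξ
  have h1 := norm_nonneg (ξ - η)
  have h2 := norm_nonneg η
  have p1 : (0 : ℝ) ≤ (1 + ‖ξ - η‖ ^ 2) ^ (s / 2) := by positivity
  have p2 : (0 : ℝ) ≤ (1 + ‖η‖ ^ 2) ^ (s / 2) := by positivity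
  have p3 : (0 : ℝ) ≤ 4 ^ (s / 2) := by positivity
  rcases le_total ‖ξ - η‖ ‖η‖ with h | h
  · have : (1 + ‖ξ‖ ^ 2) ^ (s / 2) ≤ (4 * (1 + ‖η‖ ^ 2)) ^ (s / 2) :=
      Real.rpow_le_rpow (by positivity) (by nlinarith) (by positivity)
    rw [Real.mul_rpow (by norm_num) (by positivity)] at this
    nlinarith
  · have : (1 + ‖ξ‖ ^ 2) ^ (s / 2) ≤ (4 * (1 + ‖ξ - η‖ ^ 2)) ^ (s / 2) :=
      Real.rpow_le_rpow (by positivity) (by nlinarith) (by positivity)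
    rw [Real.mul_rpow (by norm_num) (by positivity)] at this
    nlinarith

lemma HsNormSq_eq (s : ℝ) (f : E3 → ℂ) :
    HsNormSq s f = ∫⁻ ξ, (sobolevWeight s ξ * ‖𝓕 f ξ‖ₑ) ^ 2 := by
  simp only [HsNormSq, mul_pow, sobolevWeight_sq]
  rfl

/-- The constant `∫ (1 + |ξ|²)^(-s) dξ`. -/
def sobolevConst (s : ℝ) : ℝ≥0∞ := ∫⁻ ξ : E3, ENNReal.ofReal ((1 + ‖ξ‖ ^ 2) ^ (-s))

lemma sobolevConst_lt_top {s : ℝ} (hs : 3 / 2 < s) : sobolevConst s < ⊤ := by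
  have h := integrable_rpow_neg_one_add_norm_sq (E := E3) (μ := volume) (r := 2 * s)
    (by simp; linarith)
  have h' := h.lintegral_lt_top
  simpa [sobolevConst, neg_div] using h'

lemma sq_lintegral_fourier_le (s : ℝ) {f : E3 → ℂ} (hf : Integrable f) :
    (∫⁻ ξ, ‖𝓕 f ξ‖ₑ) ^ 2 ≤ sobolevConst s * HsNormSq s f := by
  have hm : Measurable fun ξ => ‖𝓕 f ξ‖ₑ := (continuous_fourier hf).measurable.enorm
  have h := sq_lintegral_mul_le (measurable_sobolevWeight (-s))
    ((measurable_sobolevWeight s).mul hm)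
  have hw : ∀ ξ, sobolevWeight (-s) ξ * sobolevWeight s ξ = 1 := fun ξ => by
    rw [sobolevWeight, sobolevWeight, ← ENNReal.ofReal_mul (by positivity),
      ← Real.rpow_add (by positivity)]
    simp [neg_div]
  simpa only [Pi.mul_apply, ← mul_assoc, hw, one_mul, ← HsNormSq_eq, sobolevWeight_sq,
    sobolevConst] using h

/-- Integrable functions with finite `H^s` norm. -/
structure MemHs (s : ℝ) (f : E3 → ℂ) : Prop where
  integrable : Integrable f
  lt_top : HsNormSq s f < ⊤

lemma MemHs.integrable_fourier {s : ℝ} (hs : 3 / 2 < s) {f : E3 → ℂ} (hf : MemHs s f) :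
    Integrable (𝓕 f) := by
  refine ⟨(continuous_fourier hf.integrable).aestronglyMeasurable, ?_⟩
  have h := (sq_lintegral_fourier_le s hf.integrable).trans_lt
    (ENNReal.mul_lt_top (sobolevConst_lt_top hs) hf.lt_top)
  simpa [HasFiniteIntegral] using h

/-- The constant in the algebra property of `H^s`. -/
def algebraConst (s : ℝ) : ℝ≥0∞ := ENNReal.ofReal (4 ^ (s / 2)) ^ 2 * 4 * sobolevConst s

lemma algebraConst_lt_top {s : ℝ} (hs : 3 / 2 < s) : algebraConst s < ⊤ :=
  ENNReal.mul_lt_top (ENNReal.mul_lt_top (ENNReal.pow_lt_top ENNReal.ofReal_lt_top) (by simp))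
    (sobolevConst_lt_top hs)

lemma add_sq_le_two_mul (a b : ℝ≥0∞) : (a + b) ^ 2 ≤ 2 * (a ^ 2 + b ^ 2) := by
  have h := ENNReal.rpow_add_le_mul_rpow_add_rpow a b (p := 2) (by norm_num)
  norm_num at h
  simpa using h

lemma HsNormSq_mul_le {s : ℝ} (hs : 3 / 2 < s) {f g : E3 → ℂ} (hf : MemHs s f)
    (hg : MemHs s g) :
    HsNormSq s (fun x => f x * g x) ≤ algebraConst s * (HsNormSq s f * HsNormSq s g) := by
  have hcf : Measurable (𝓕 f) := (continuous_fourier hf.integrable).measurable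
  have hcg : Measurable (𝓕 g) := (continuous_fourier hg.integrable).measurable
  have hmf : Measurable fun ξ => ‖𝓕 f ξ‖ₑ := hcf.enorm
  have hmg : Measurable fun ξ => ‖𝓕 g ξ‖ₑ := hcg.enorm
  have hw := measurable_sobolevWeight s
  set c : ℝ≥0∞ := ENNReal.ofReal (4 ^ (s / 2))
  set F : E3 → ℝ≥0∞ := fun ξ => sobolevWeight s ξ * ‖𝓕 f ξ‖ₑ with hF
  set G : E3 → ℝ≥0∞ := fun ξ => sobolevWeight s ξ * ‖𝓕 g ξ‖ₑ with hG
  have hmF : Measurable F := hw.mul hmf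
  have hmG : Measurable G := hw.mul hmg
  have hA : ∀ ξ, ∫⁻ η, ‖𝓕 f (ξ - η)‖ₑ * G η = ∫⁻ η, G (ξ - η) * ‖𝓕 f η‖ₑ := fun ξ => by
    rw [← lintegral_sub_left_eq_self _ ξ]
    simp [mul_comm]
  have key : ∀ ξ, sobolevWeight s ξ * ‖𝓕 (fun x => f x * g x) ξ‖ₑ ≤
      c * ((∫⁻ η, F (ξ - η) * ‖𝓕 g η‖ₑ) + ∫⁻ η, G (ξ - η) * ‖𝓕 f η‖ₑ) := fun ξ => by
    rw [fourier_mul_eq hf.integrable hg.integrable (hg.integrable_fourier hs)]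
    calc sobolevWeight s ξ * ‖∫ η, 𝓕 f (ξ - η) * 𝓕 g η‖ₑ
        ≤ sobolevWeight s ξ * ∫⁻ η, ‖𝓕 f (ξ - η)‖ₑ * ‖𝓕 g η‖ₑ := by
          gcongr
          refine (enorm_integral_le_lintegral_enorm _).trans_eq ?_
          simp
      _ = ∫⁻ η, sobolevWeight s ξ * (‖𝓕 f (ξ - η)‖ₑ * ‖𝓕 g η‖ₑ) :=
          (lintegral_const_mul _ (by fun_prop)).symm
      _ ≤ ∫⁻ η, c * (F (ξ - η) * ‖𝓕 g η‖ₑ + ‖𝓕 f (ξ - η)‖ₑ * G η) := by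
          refine lintegral_mono fun η => ?_
          refine (mul_le_mul_left (sobolevWeight_le_add (by linarith) ξ η) _).trans_eq ?_
          simp only [hF, hG]
          ring
      _ = _ := by
          rw [lintegral_const_mul _ (by fun_prop), lintegral_add_left (by fun_prop), hA]
  have hmFg : Measurable fun ξ => (∫⁻ η, F (ξ - η) * ‖𝓕 g η‖ₑ) ^ 2 :=
    (Measurable.lintegral_prod_right'
      (by fun_prop : Measurable fun p : E3 × E3 => F (p.1 - p.2) * ‖𝓕 g p.2‖ₑ)).pow_const 2
  calc HsNormSq s (fun x => f x * g x)
      ≤ ∫⁻ ξ, (c ^ 2 * 2) * ((∫⁻ η, F (ξ - η) * ‖𝓕 g η‖ₑ) ^ 2 +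
          (∫⁻ η, G (ξ - η) * ‖𝓕 f η‖ₑ) ^ 2) := by
        rw [HsNormSq_eq]
        refine lintegral_mono fun ξ => (pow_le_pow_left' (key ξ) 2).trans ?_
        rw [mul_pow, mul_assoc]
        gcongr
        exact add_sq_le_two_mul _ _
    _ = (c ^ 2 * 2) * ((∫⁻ ξ, (∫⁻ η, F (ξ - η) * ‖𝓕 g η‖ₑ) ^ 2) +
          ∫⁻ ξ, (∫⁻ η, G (ξ - η) * ‖𝓕 f η‖ₑ) ^ 2) := by
        rw [lintegral_const_mul' _ _ (by simp [c, ENNReal.mul_eq_top]), lintegral_add_left hmFg]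
    _ ≤ (c ^ 2 * 2) * (sobolevConst s * HsNormSq s g * HsNormSq s f +
          sobolevConst s * HsNormSq s f * HsNormSq s g) := by
        gcongr
        · refine (lintegral_sq_convolution_le hmF hmg).trans ?_
          rw [HsNormSq_eq s f]
          gcongr
          exact sq_lintegral_fourier_le s hg.integrable
        · refine (lintegral_sq_convolution_le hmG hmf).trans ?_
          rw [HsNormSq_eq s g]
          gcongr
          exact sq_lintegral_fourier_le s hf.integrable
    _ = _ := by
        rw [algebraConst]
        ring

lemma MemHs.mul {s : ℝ} (hs : 3 / 2 < s) {f g : E3 → ℂ} (hf : MemHs s f) (hg : MemHs s g) :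
    MemHs s fun x => f x * g x :=
  ⟨integrable_mul_of_integrable_fourier hf.integrable hg.integrable (hg.integrable_fourier hs),
    (HsNormSq_mul_le hs hf hg).trans_lt
      (ENNReal.mul_lt_top (algebraConst_lt_top hs) (ENNReal.mul_lt_top hf.lt_top hg.lt_top))⟩

lemma MemHs.pow_succ {s : ℝ} (hs : 3 / 2 < s) {f : E3 → ℂ} (hf : MemHs s f) (n : ℕ) :
    MemHs s (fun x => f x ^ (n + 1)) ∧
      HsNormSq s (fun x => f x ^ (n + 1)) ≤ algebraConst s ^ n * HsNormSq s f ^ (n + 1) := by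
  induction n with
  | zero => simpa using hf
  | succ n ih =>
    simp only [_root_.pow_succ _ (n + 1)]
    refine ⟨ih.1.mul hs hf, (HsNormSq_mul_le hs ih.1 hf).trans ?_⟩
    calc algebraConst s * (HsNormSq s (fun x => f x ^ (n + 1)) * HsNormSq s f)
        ≤ algebraConst s * (algebraConst s ^ n * HsNormSq s f ^ (n + 1) * HsNormSq s f) := by
          gcongr
          exact ih.2
      _ = _ := by ring

lemma fourier_add_apply {f g : E3 → ℂ} (hf : Integrable f) (hg : Integrable g) (ξ : E3) :
    𝓕 (fun x => f x + g x) ξ = 𝓕 f ξ + 𝓕 g ξ := by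
  simp only [Real.fourier_eq, smul_add]
  exact integral_add ((Real.fourierIntegral_convergent_iff ξ).2 hf)
    ((Real.fourierIntegral_convergent_iff ξ).2 hg)

lemma HsNormSq_neg (s : ℝ) (f : E3 → ℂ) : HsNormSq s (fun x => -f x) = HsNormSq s f := by
  have h : ∀ ξ, 𝓕 (fun x => -f x) ξ = -𝓕 f ξ := fun ξ => by
    simp only [Real.fourier_eq, smul_neg, integral_neg]
  simp only [HsNormSq, h, nnnorm_neg]

lemma HsNormSq_add_le (s : ℝ) {f g : E3 → ℂ} (hf : Integrable f) (hg : Integrable g) :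
    HsNormSq s (fun x => f x + g x) ≤ 2 * (HsNormSq s f + HsNormSq s g) := by
  have hmf : Measurable fun ξ => ‖𝓕 f ξ‖ₑ := (continuous_fourier hf).measurable.enorm
  have hw := measurable_sobolevWeight s
  simp only [HsNormSq_eq]
  rw [← lintegral_add_left (by fun_prop), ← lintegral_const_mul' _ _ (by simp)]
  refine lintegral_mono fun ξ => ?_
  rw [fourier_add_apply hf hg]
  refine le_trans ?_ (add_sq_le_two_mul _ _)
  rw [← mul_add]
  gcongr
  exact enorm_add_le _ _

lemma MemHs.add {s : ℝ} {f g : E3 → ℂ} (hf : MemHs s f) (hg : MemHs s g) :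
    MemHs s fun x => f x + g x :=
  ⟨hf.integrable.add hg.integrable,
    (HsNormSq_add_le s hf.integrable hg.integrable).trans_lt
      (ENNReal.mul_lt_top (by simp) (ENNReal.add_lt_top.2 ⟨hf.lt_top, hg.lt_top⟩))⟩

lemma MemHs.neg {s : ℝ} {f : E3 → ℂ} (hf : MemHs s f) : MemHs s fun x => -f x :=
  ⟨hf.integrable.neg, (HsNormSq_neg s f).trans_lt hf.lt_top⟩

/-- Multiplication by `1 - φ` is bounded on `H^s` if `φ` lies in `H^s`. -/
lemma MemHs.one_sub_mul {s : ℝ} (hs : 3 / 2 < s) {φ f : E3 → ℂ} (hφ : MemHs s φ)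
    (hf : MemHs s f) {M : ℝ≥0∞} (hM : HsNormSq s φ ≤ M) :
    MemHs s (fun x => (1 - φ x) * f x) ∧
      HsNormSq s (fun x => (1 - φ x) * f x) ≤
        2 * (1 + algebraConst s * M) * HsNormSq s f := by
  have heq : (fun x => (1 - φ x) * f x) = fun x => f x + -(φ x * f x) := by
    ext x
    ring
  rw [heq]
  refine ⟨hf.add (hφ.mul hs hf).neg, ?_⟩
  refine (HsNormSq_add_le s hf.integrable (hφ.mul hs hf).neg.integrable).trans ?_
  rw [HsNormSq_neg, mul_assoc, add_mul, one_mul, mul_assoc]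
  gcongr
  exact (HsNormSq_mul_le hs hφ hf).trans (by gcongr)

/-! ### Dilations -/

lemma fourier_comp_smul {c : ℝ} (hc : c ≠ 0) (f : E3 → ℂ) (ξ : E3) :
    𝓕 (fun x => f (c • x)) ξ = |(c ^ 3)⁻¹| • 𝓕 f (c⁻¹ • ξ) := by
  have h := Measure.integral_comp_smul (volume : Measure E3)
    (fun y => 𝐞 (-inner ℝ y (c⁻¹ • ξ)) • f y) c
  rw [finrank_euclideanSpace_fin] at h
  rw [Real.fourier_eq, Real.fourier_eq, ← h]
  congr 1 with x
  rw [inner_smul_left, inner_smul_right]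
  simp [hc]

lemma lintegral_comp_smul {c : ℝ} (hc : c ≠ 0) (g : E3 → ℝ≥0∞) :
    ∫⁻ x, g (c • x) = ENNReal.ofReal |(c ^ 3)⁻¹| * ∫⁻ x, g x := by
  have h := lintegral_map_equiv (μ := (volume : Measure E3)) g
    (Homeomorph.smulOfNeZero c hc).toMeasurableEquiv
  have hmap : Measure.map (Homeomorph.smulOfNeZero c hc).toMeasurableEquiv volume =
      ENNReal.ofReal |(c ^ 3)⁻¹| • (volume : Measure E3) := by
    have := Measure.map_addHaar_smul (volume : Measure E3) hc
    rwa [finrank_euclideanSpace_fin] at this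
  rw [hmap, lintegral_smul_measure] at h
  exact h.symm

lemma exists_HsNormSq_comp_smul_le {s : ℝ} (hs : 0 ≤ s) {c : ℝ} (hc : c ≠ 0) :
    ∃ D : ℝ≥0∞, D < ⊤ ∧
      ∀ f : E3 → ℂ, HsNormSq s (fun x => f (c • x)) ≤ D * HsNormSq s f := by
  refine ⟨ENNReal.ofReal ((1 + c ^ 2) ^ s) * ENNReal.ofReal |(c ^ 3)⁻¹| ^ 2 *
    ENNReal.ofReal |((c⁻¹) ^ 3)⁻¹|, ?_, fun f => ?_⟩
  · exact ENNReal.mul_lt_top (ENNReal.mul_lt_top ENNReal.ofReal_lt_top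
      (ENNReal.pow_lt_top ENNReal.ofReal_lt_top)) ENNReal.ofReal_lt_top
  have hweight : ∀ ξ : E3, ENNReal.ofReal ((1 + ‖ξ‖ ^ 2) ^ s) ≤
      ENNReal.ofReal ((1 + c ^ 2) ^ s) * ENNReal.ofReal ((1 + ‖c⁻¹ • ξ‖ ^ 2) ^ s) := fun ξ => by
    rw [← ENNReal.ofReal_mul (by positivity), ← Real.mul_rpow (by positivity) (by positivity)]
    refine ENNReal.ofReal_le_ofReal (Real.rpow_le_rpow (by positivity) ?_ hs)
    have hξ : ‖ξ‖ ^ 2 = c ^ 2 * ‖c⁻¹ • ξ‖ ^ 2 := by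
      rw [norm_smul, norm_inv, mul_pow, ← mul_assoc, inv_pow, Real.norm_eq_abs, sq_abs,
        mul_inv_cancel₀ (pow_ne_zero 2 hc), one_mul]
    rw [hξ]
    nlinarith [sq_nonneg c, sq_nonneg ‖c⁻¹ • ξ‖]
  have henorm : ∀ ξ, (‖𝓕 (fun x => f (c • x)) ξ‖₊ : ℝ≥0∞) =
      ENNReal.ofReal |(c ^ 3)⁻¹| * (‖𝓕 f (c⁻¹ • ξ)‖₊ : ℝ≥0∞) := fun ξ => by
    rw [fourier_comp_smul hc, nnnorm_smul, ENNReal.coe_mul]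
    congr 1
    rw [← enorm_eq_nnnorm, Real.enorm_eq_ofReal_abs, abs_abs]
  calc HsNormSq s (fun x => f (c • x))
      ≤ ∫⁻ ξ, (ENNReal.ofReal ((1 + c ^ 2) ^ s) * ENNReal.ofReal |(c ^ 3)⁻¹| ^ 2) *
          (ENNReal.ofReal ((1 + ‖c⁻¹ • ξ‖ ^ 2) ^ s) * (‖𝓕 f (c⁻¹ • ξ)‖₊ : ℝ≥0∞) ^ 2) := by
        refine lintegral_mono fun ξ => ?_
        simp only [henorm]
        refine (mul_le_mul_left (hweight ξ) _).trans_eq ?_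
        ring
    _ = _ := by
        rw [lintegral_const_mul' _ _ (ENNReal.mul_ne_top ENNReal.ofReal_ne_top
          (ENNReal.pow_ne_top ENNReal.ofReal_ne_top)),
          lintegral_comp_smul (inv_ne_zero hc) (fun ξ : E3 =>
            ENNReal.ofReal ((1 + ‖ξ‖ ^ 2) ^ s) * (‖𝓕 f ξ‖₊ : ℝ≥0∞) ^ 2), ← mul_assoc]
        rfl

/-- Dilations by factors from a finite set are uniformly bounded on `H^s`. -/
lemma exists_MemHs_comp_smul {s : ℝ} (hs : 0 ≤ s) {t : Finset ℝ} (ht : ∀ c ∈ t, c ≠ 0) :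
    ∃ D : ℝ≥0∞, D < ⊤ ∧ ∀ c ∈ t, ∀ f : E3 → ℂ, MemHs s f →
      MemHs s (fun x => f (c • x)) ∧ HsNormSq s (fun x => f (c • x)) ≤ D * HsNormSq s f := by
  choose! D hD hle using fun c (hc : c ∈ t) => exists_HsNormSq_comp_smul_le hs (ht c hc)
  have htop : ∑ c ∈ t, D c < ⊤ := ENNReal.sum_lt_top.2 hD
  refine ⟨∑ c ∈ t, D c, htop, fun c hc f hf => ?_⟩
  have hbound : HsNormSq s (fun x => f (c • x)) ≤ (∑ c ∈ t, D c) * HsNormSq s f :=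
    (hle c hc f).trans (by gcongr; exact Finset.single_le_sum (f := D) (fun _ _ => zero_le) hc)
  exact ⟨⟨hf.integrable.comp_smul (ht c hc),
    hbound.trans_lt (ENNReal.mul_lt_top htop hf.lt_top)⟩, hbound⟩

/-! ### Uniform bounds for smooth functions with compact support -/

lemma integral_norm_iteratedFDeriv_le {g : E3 → ℂ} {R C : ℝ} {n : ℕ}
    (hsupp : ∀ x, g x ≠ 0 → ‖x‖ ≤ R) (hbd : ∀ x, ‖iteratedFDeriv ℝ n g x‖ ≤ C) :
    ∫ x, ‖iteratedFDeriv ℝ n g x‖ ≤ C * volume.real (Metric.closedBall (0 : E3) R) := by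
  have hts : tsupport g ⊆ Metric.closedBall (0 : E3) R :=
    closure_minimal (fun x hx => by simpa using hsupp x hx) Metric.isClosed_closedBall
  rw [← setIntegral_eq_integral_of_forall_compl_eq_zero (s := Metric.closedBall (0 : E3) R)]
  · refine (Real.le_norm_self _).trans
      (norm_setIntegral_le_of_norm_le_const measure_closedBall_lt_top fun x _ => ?_)
    simpa using hbd x
  · intro x hx
    rw [norm_eq_zero]
    by_contra h
    exact hx (hts (support_iteratedFDeriv_subset n h))

lemma pow_mul_norm_fourier_le {g : E3 → ℂ} {R : ℝ} {C : ℕ → ℝ} (hg : ContDiff ℝ (⊤ : ℕ∞) g)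
    (hsupp : ∀ x, g x ≠ 0 → ‖x‖ ≤ R) (hbd : ∀ n x, ‖iteratedFDeriv ℝ n g x‖ ≤ C n)
    (n : ℕ) (ξ : E3) :
    ‖ξ‖ ^ n * ‖𝓕 g ξ‖ ≤ 2 ^ n *
      ∑ p ∈ Finset.range (n + 1), C p * volume.real (Metric.closedBall (0 : E3) R) := by
  have hcs : HasCompactSupport g := HasCompactSupport.of_support_subset_isCompact
    (isCompact_closedBall (0 : E3) R) fun x hx => by simpa using hsupp x hx
  have h := Real.pow_mul_norm_iteratedFDeriv_fourier_le (K := 0) (N := ⊤) hg (fun k n hk _ => by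
    have hk0 : k = 0 := by simpa using hk
    have hc := hg.continuous_iteratedFDeriv (m := n) (mod_cast le_top)
    simpa [hk0] using (hc.integrable_of_hasCompactSupport (hcs.iteratedFDeriv n)).norm)
    (k := 0) (n := n) le_rfl le_top ξ
  simp only [norm_iteratedFDeriv_zero, pow_zero, one_mul, CharP.cast_eq_zero, mul_zero, zero_add,
    Finset.range_one, Finset.sum_product, Finset.sum_singleton] at h
  refine h.trans ?_
  gcongr with p
  exact integral_norm_iteratedFDeriv_le hsupp (hbd p)

lemma exists_MemHs_of_iteratedFDeriv_le {s : ℝ} (hs : 3 / 2 < s) (R : ℝ) (C : ℕ → ℝ) :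
    ∃ M : ℝ≥0∞, M < ⊤ ∧ ∀ g : E3 → ℂ, ContDiff ℝ (⊤ : ℕ∞) g → (∀ x, g x ≠ 0 → ‖x‖ ≤ R) →
      (∀ n x, ‖iteratedFDeriv ℝ n g x‖ ≤ C n) → MemHs s g ∧ HsNormSq s g ≤ M := by
  obtain ⟨N, hN⟩ := exists_nat_ge s
  set B : ℕ → ℝ := fun n => 2 ^ n *
      ∑ p ∈ Finset.range (n + 1), C p * volume.real (Metric.closedBall (0 : E3) R)
  set b : ℝ := 2 ^ N * (B 0 + B (2 * N))
  have hM : ENNReal.ofReal (b ^ 2) * sobolevConst s < ⊤ :=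
    ENNReal.mul_lt_top ENNReal.ofReal_lt_top (sobolevConst_lt_top hs)
  refine ⟨_, hM, fun g hg hsupp hbd => ?_⟩
  have hcs : HasCompactSupport g := HasCompactSupport.of_support_subset_isCompact
    (isCompact_closedBall (0 : E3) R) fun x hx => by simpa using hsupp x hx
  suffices h : HsNormSq s g ≤ ENNReal.ofReal (b ^ 2) * sobolevConst s from
    ⟨⟨hg.continuous.integrable_of_hasCompactSupport hcs, h.trans_lt hM⟩, h⟩
  have hdecay : ∀ ξ, (1 + ‖ξ‖ ^ 2) ^ N * ‖𝓕 g ξ‖ ≤ b := fun ξ => by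
    have h0 := pow_mul_norm_fourier_le hg hsupp hbd 0 ξ
    have h1 := pow_mul_norm_fourier_le hg hsupp hbd (2 * N) ξ
    have hpow : (1 + ‖ξ‖ ^ 2) ^ N ≤ 2 ^ N * (1 + ‖ξ‖ ^ (2 * N)) := by
      have := add_pow_le (zero_le_one' ℝ) (sq_nonneg ‖ξ‖) N
      rw [one_pow, ← pow_mul] at this
      refine this.trans ?_
      gcongr
      · norm_num
      · omega
    calc (1 + ‖ξ‖ ^ 2) ^ N * ‖𝓕 g ξ‖ ≤ 2 ^ N * (1 + ‖ξ‖ ^ (2 * N)) * ‖𝓕 g ξ‖ := by gcongr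
      _ = 2 ^ N * (‖ξ‖ ^ 0 * ‖𝓕 g ξ‖ + ‖ξ‖ ^ (2 * N) * ‖𝓕 g ξ‖) := by ring
      _ ≤ b := by
        exact mul_le_mul_of_nonneg_left (add_le_add h0 h1) (by positivity)
  rw [sobolevConst, ← lintegral_const_mul' _ _ ENNReal.ofReal_ne_top]
  refine lintegral_mono fun ξ => ?_
  rw [← enorm_eq_nnnorm, ← ofReal_norm, ← ENNReal.ofReal_pow (norm_nonneg _),
    ← ENNReal.ofReal_mul (by positivity), ← ENNReal.ofReal_mul (by positivity)]
  refine ENNReal.ofReal_le_ofReal ?_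
  have hone : (1 : ℝ) ≤ 1 + ‖ξ‖ ^ 2 := by nlinarith [sq_nonneg ‖ξ‖]
  have hle : (1 + ‖ξ‖ ^ 2) ^ s ≤ (1 + ‖ξ‖ ^ 2) ^ N := by
    rw [← Real.rpow_natCast _ N]
    exact Real.rpow_le_rpow_of_exponent_le hone hN
  rw [Real.rpow_neg (by positivity), ← div_eq_mul_inv, le_div_iff₀ (by positivity)]
  calc (1 + ‖ξ‖ ^ 2) ^ s * ‖𝓕 g ξ‖ ^ 2 * (1 + ‖ξ‖ ^ 2) ^ s
      = ((1 + ‖ξ‖ ^ 2) ^ s * ‖𝓕 g ξ‖) ^ 2 := by ring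
    _ ≤ ((1 + ‖ξ‖ ^ 2) ^ N * ‖𝓕 g ξ‖) ^ 2 := by gcongr
    _ ≤ b ^ 2 := by
        gcongr
        exact hdecay ξ

/-! ### Dyadic blocks -/

namespace DyadicPartition

variable (P : DyadicPartition)

lemma eq_one_of_norm_le {k : ℕ} {x : E3} (h₁ : k = 0 ∨ (2 : ℝ) ^ ((k : ℤ) - 1) ≤ ‖x‖)
    (h₂ : ‖x‖ ≤ (2 : ℝ) ^ (k : ℤ)) : P.ψ k x = 1 := by
  rcases Nat.eq_zero_or_pos k with rfl | hk
  · exact P.one_zero x (by simpa using h₂)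
  · exact P.one_succ k hk x (h₁.resolve_left hk.ne') h₂

lemma norm_le_of_ne_zero {j : ℕ} {x : E3} (hx : P.ψ j x ≠ 0) :
    ‖x‖ ≤ (2 : ℝ) ^ ((j : ℤ) + 1) := by
  rcases Nat.eq_zero_or_pos j with rfl | hj
  · simpa using P.supp_zero x hx
  · exact (P.supp_succ j hj x hx).2

/-- On the support of `ψ j` one of the neighbouring cutoffs equals `1`. -/
lemma prod_one_sub_eq_zero {j : ℕ} {x : E3} (hx : P.ψ j x ≠ 0) :
    (1 - P.ψ (j - 1) x) * ((1 - P.ψ j x) * (1 - P.ψ (j + 1) x)) = 0 := by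
  have hup := P.norm_le_of_ne_zero hx
  rcases le_total ‖x‖ ((2 : ℝ) ^ (j : ℤ)) with h | h
  · rcases Nat.eq_zero_or_pos j with rfl | hj
    · simp [P.eq_one_of_norm_le (Or.inl rfl) h]
    rcases le_total ‖x‖ ((2 : ℝ) ^ ((j : ℤ) - 1)) with h' | h'
    · have hcast : ((j - 1 : ℕ) : ℤ) = j - 1 := by omega
      rw [P.eq_one_of_norm_le (k := j - 1) (Or.inr ?_) (by rwa [hcast])]
      · simp
      · rw [hcast, sub_sub]
        exact (P.supp_succ j hj x hx).1
    · simp [P.eq_one_of_norm_le (Or.inr h') h]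
  · rw [P.eq_one_of_norm_le (k := j + 1) (Or.inr ?_) (by exact_mod_cast hup)]
    · simp
    · simpa using h

lemma exists_eq_one {x : E3} {N : ℕ} (hx : ‖x‖ ≤ (2 : ℝ) ^ N) : ∃ k ≤ N, P.ψ k x = 1 := by
  classical
  have hex : ∃ k : ℕ, ‖x‖ ≤ (2 : ℝ) ^ k := ⟨N, hx⟩
  refine ⟨Nat.find hex, Nat.find_min' hex hx,
    P.eq_one_of_norm_le ?_ (by exact_mod_cast Nat.find_spec hex)⟩
  rcases Nat.eq_zero_or_pos (Nat.find hex) with h | h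
  · exact Or.inl h
  · right
    have hlt := (not_le.1 (Nat.find_min hex (Nat.sub_lt h one_pos))).le
    rwa [← zpow_natCast, Nat.cast_sub (by omega), Nat.cast_one] at hlt

/-- The cutoff `ψ k` in the coordinates of scale `2 ^ j`. -/
def cutoff (j k : ℕ) (x : E3) : ℂ := (P.ψ k ((2 : ℝ) ^ j • x) : ℂ)

/-- The rescaled dyadic block `(ψ_j u)_{2^j}`. -/
def block (u : E3 → ℝ) (j : ℕ) (x : E3) : ℂ :=
  ((P.ψ j ((2 : ℝ) ^ j • x) * u ((2 : ℝ) ^ j • x) : ℝ) : ℂ)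

lemma exists_cutoff_bound {s : ℝ} (hs : 3 / 2 < s) :
    ∃ M : ℝ≥0∞, M < ⊤ ∧ ∀ j, MemHs s (P.cutoff j j) ∧ HsNormSq s (P.cutoff j j) ≤ M := by
  choose C hC using P.deriv_bound
  obtain ⟨M, hM, h⟩ := exists_MemHs_of_iteratedFDeriv_le hs 2 C
  refine ⟨M, hM, fun j => h _ ?_ (fun x hx => ?_) fun n x => ?_⟩
  · exact Complex.ofRealCLM.contDiff.comp ((P.smooth j).comp (contDiff_const_smul _))
  · have hx' : P.ψ j ((2 : ℝ) ^ j • x) ≠ 0 := by simpa [cutoff] using hx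
    have := P.norm_le_of_ne_zero hx'
    rw [norm_smul, norm_pow, Real.norm_ofNat, zpow_add_one₀ two_ne_zero, zpow_natCast] at this
    exact le_of_mul_le_mul_left this (by positivity)
  · have hsm : ContDiff ℝ n (P.ψ j) := (P.smooth j).of_le (mod_cast le_top)
    have h1 := Complex.ofRealLI.norm_iteratedFDeriv_comp_left
      (f := fun x : E3 => P.ψ j ((2 : ℝ) ^ j • x)) (x := x) (n := n) (i := n)
      (hsm.comp (contDiff_const_smul _)).contDiffAt le_rfl
    have h2 : iteratedFDeriv ℝ n (P.cutoff j j) x =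
        iteratedFDeriv ℝ n (Complex.ofRealLI ∘ fun x : E3 => P.ψ j ((2 : ℝ) ^ j • x)) x := rfl
    rw [h2, h1, iteratedFDeriv_comp_const_smul _ hsm, norm_smul]
    refine (mul_le_mul_of_nonneg_left (hC n j _) (norm_nonneg _)).trans_eq ?_
    rw [mul_left_comm, norm_pow, norm_pow, Real.norm_ofNat, ← pow_mul, neg_mul, zpow_neg,
      mul_comm (n : ℤ), ← Nat.cast_mul, zpow_natCast, mul_inv_cancel₀ (by positivity), mul_one]

lemma exists_dilation_factor {j k : ℕ} (hk : k = j - 1 ∨ k = j ∨ k = j + 1) :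
    ∃ c ∈ ({2⁻¹, 1, 2} : Finset ℝ), ∀ x : E3, (2 : ℝ) ^ j • x = (2 : ℝ) ^ k • c • x := by
  rcases hk with rfl | rfl | rfl
  · rcases Nat.eq_zero_or_pos j with rfl | hj
    · exact ⟨1, by simp, by simp⟩
    · refine ⟨2, by simp, fun x => ?_⟩
      rw [smul_smul, ← pow_succ, Nat.sub_add_cancel hj]
  · exact ⟨1, by simp, by simp⟩
  · refine ⟨2⁻¹, by simp, fun x => ?_⟩
    rw [smul_smul, pow_succ, mul_assoc, mul_inv_cancel₀ two_ne_zero, mul_one]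

/-- On the support of `ψ j` the function `u` is reconstructed from the neighbouring blocks. -/
lemma block_pow_eq (u : E3 → ℝ) {m : ℕ} (j : ℕ) :
    P.block (fun x => u x ^ m) j = fun x => P.cutoff j j x *
      (P.cutoff j (j - 1) x * (u ((2 : ℝ) ^ j • x) : ℂ) +
        ((1 - P.cutoff j (j - 1) x) * (P.cutoff j j x * (u ((2 : ℝ) ^ j • x) : ℂ)) +
          (1 - P.cutoff j (j - 1) x) * ((1 - P.cutoff j j x) *
            (P.cutoff j (j + 1) x * (u ((2 : ℝ) ^ j • x) : ℂ))))) ^ m := by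
  ext x
  simp only [block, cutoff]
  by_cases hx : P.ψ j ((2 : ℝ) ^ j • x) = 0
  · simp [hx]
  · have h : (1 - (P.ψ (j - 1) ((2 : ℝ) ^ j • x) : ℂ)) * ((1 - (P.ψ j ((2 : ℝ) ^ j • x) : ℂ)) *
        (1 - (P.ψ (j + 1) ((2 : ℝ) ^ j • x) : ℂ))) = 0 := by
      exact_mod_cast P.prod_one_sub_eq_zero hx
    push_cast
    congr 2
    linear_combination (u ((2 : ℝ) ^ j • x) : ℂ) * h

/-- The local power estimate: a block of `u ^ m` is controlled by the neighbouring blocks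
of `u`. -/
lemma exists_block_pow_bound {s : ℝ} (hs : 3 / 2 < s) (n : ℕ) :
    ∃ R : ℝ≥0∞, R < ⊤ ∧ ∀ u : E3 → ℝ, (∀ k, MemHs s (P.block u k)) → ∀ j,
      MemHs s (P.block (fun x => u x ^ (n + 1)) j) ∧
      HsNormSq s (P.block (fun x => u x ^ (n + 1)) j) ≤
        R * (HsNormSq s (P.block u (j - 1)) + HsNormSq s (P.block u j) +
          HsNormSq s (P.block u (j + 1))) ^ (n + 1) := by
  obtain ⟨D, hD, hdil⟩ := exists_MemHs_comp_smul (s := s) (by linarith)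
    (t := {2⁻¹, 1, 2}) (by simp)
  obtain ⟨M₀, hM₀, hcut₀⟩ := P.exists_cutoff_bound hs
  set K := algebraConst s
  have hK : K < ⊤ := algebraConst_lt_top hs
  set M := D * M₀
  have hM : M < ⊤ := ENNReal.mul_lt_top hD hM₀
  set L := 2 * (1 + K * M)
  have hL : L < ⊤ := ENNReal.mul_lt_top (by simp)
    (ENNReal.add_lt_top.2 ⟨by simp, ENNReal.mul_lt_top hK hM⟩)
  set Q := 4 * (1 + L + L * L) * D
  have hQ : Q < ⊤ := ENNReal.mul_lt_top (ENNReal.mul_lt_top (by simp)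
    (ENNReal.add_lt_top.2 ⟨ENNReal.add_lt_top.2 ⟨by simp, hL⟩, ENNReal.mul_lt_top hL hL⟩)) hD
  refine ⟨K * M * K ^ n * Q ^ (n + 1), ENNReal.mul_lt_top (ENNReal.mul_lt_top
    (ENNReal.mul_lt_top hK hM) (ENNReal.pow_lt_top hK)) (ENNReal.pow_lt_top hQ),
    fun u hu j => ?_⟩
  have hcut : ∀ k, (k = j - 1 ∨ k = j ∨ k = j + 1) →
      MemHs s (P.cutoff j k) ∧ HsNormSq s (P.cutoff j k) ≤ M := fun k hk => by
    obtain ⟨c, hc, hx⟩ := exists_dilation_factor hk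
    have heq : P.cutoff j k = fun x => P.cutoff k k (c • x) := by
      ext x
      simp only [cutoff, hx]
    obtain ⟨h1, h2⟩ := hdil c hc _ (hcut₀ k).1
    rw [heq]
    exact ⟨h1, h2.trans (mul_le_mul_right (hcut₀ k).2 D)⟩
  have hblk : ∀ k, (k = j - 1 ∨ k = j ∨ k = j + 1) →
      MemHs s (fun x => P.cutoff j k x * (u ((2 : ℝ) ^ j • x) : ℂ)) ∧
      HsNormSq s (fun x => P.cutoff j k x * (u ((2 : ℝ) ^ j • x) : ℂ)) ≤
        D * HsNormSq s (P.block u k) := fun k hk => by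
    obtain ⟨c, hc, hx⟩ := exists_dilation_factor hk
    have heq : (fun x => P.cutoff j k x * (u ((2 : ℝ) ^ j • x) : ℂ)) =
        fun x => P.block u k (c • x) := by
      ext x
      simp only [cutoff, block, hx, Complex.ofReal_mul]
    rw [heq]
    exact hdil c hc _ (hu k)
  obtain ⟨hφ₁, hφ₁M⟩ := hcut (j - 1) (by simp)
  obtain ⟨hφ₂, hφ₂M⟩ := hcut j (by simp)
  obtain ⟨ha, haD⟩ := hblk (j - 1) (by simp)
  obtain ⟨hb, hbD⟩ := hblk j (by simp)
  obtain ⟨hc, hcD⟩ := hblk (j + 1) (by simp)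
  obtain ⟨hb', hbL⟩ := hφ₁.one_sub_mul hs hb hφ₁M
  obtain ⟨hc', hcL⟩ := hφ₂.one_sub_mul hs hc hφ₂M
  obtain ⟨hc'', hcL'⟩ := hφ₁.one_sub_mul hs hc' hφ₁M
  set a := HsNormSq s (P.block u (j - 1))
  set b := HsNormSq s (P.block u j)
  set d := HsNormSq s (P.block u (j + 1))
  have hsum := ha.add (hb'.add hc'')
  have hsumQ := (HsNormSq_add_le s ha.integrable (hb'.add hc'').integrable).trans
    (mul_le_mul_right (add_le_add le_rfl (HsNormSq_add_le s hb'.integrable hc''.integrable)) 2)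
  have hsumQ' := calc
    _ ≤ 2 * (D * a + 2 * (L * (D * b) + L * (L * (D * d)))) := by
        refine hsumQ.trans ?_
        gcongr
        · exact hbL.trans (by gcongr)
        · exact hcL'.trans (by gcongr; exact hcL.trans (by gcongr))
    _ ≤ 2 * (2 * ((1 + L + L * L) * D * a) + 2 * ((1 + L + L * L) * D * b +
          (1 + L + L * L) * D * d)) := by
        have e1 : D * a ≤ 2 * ((1 + L + L * L) * D * a) := by
          calc D * a = 1 * (1 * D * a) := by ring
            _ ≤ _ := by
              gcongr
              · norm_num
              · rw [add_assoc]
                exact le_self_add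
        have e2 : L * (D * b) ≤ (1 + L + L * L) * D * b := by
          rw [← mul_assoc]
          gcongr
          exact le_add_self.trans le_self_add
        have e3 : L * (L * (D * d)) ≤ (1 + L + L * L) * D * d := by
          rw [← mul_assoc, ← mul_assoc]
          gcongr
          exact le_add_self
        gcongr
    _ = Q * (a + b + d) := by ring
  obtain ⟨hp, hpK⟩ := hsum.pow_succ hs n
  rw [P.block_pow_eq u j]
  refine ⟨hφ₂.mul hs hp, (HsNormSq_mul_le hs hφ₂ hp).trans ?_⟩
  calc _ ≤ K * (M * (K ^ n * (Q * (a + b + d)) ^ (n + 1))) := by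
        gcongr
        exact hpK.trans (by gcongr)
    _ = _ := by
        rw [mul_pow]
        ring

lemma integrable_block {u : E3 → ℝ} (hu : LocallyIntegrable u volume) (j : ℕ) :
    Integrable (P.block u j) := by
  have h : Integrable fun x => P.ψ j x * u x := by
    simpa using hu.integrable_smul_left_of_hasCompactSupport (P.smooth j).continuous
      (P.compSupp j)
  exact (h.comp_smul (R := (2 : ℝ) ^ j) (by positivity)).ofReal

/-- A function all of whose dyadic blocks are integrable is locally integrable. -/
lemma locallyIntegrable_of_block {u : E3 → ℝ} (hu : ∀ j, Integrable (P.block u j)) :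
    LocallyIntegrable u volume := by
  have hψ : ∀ k, Integrable fun x => P.ψ k x * u x := fun k => by
    have h := (hu k).re
    exact (integrable_comp_smul_iff volume (fun x => P.ψ k x * u x)
      (R := (2 : ℝ) ^ k) (by positivity)).1 h
  have hone : ∀ k, IntegrableOn u {x | P.ψ k x = 1} := fun k => by
    have hmeas : MeasurableSet {x | P.ψ k x = 1} :=
      (isClosed_singleton.preimage (P.smooth k).continuous).measurableSet
    refine (hψ k).integrableOn.congr_fun (fun x hx => ?_) hmeas
    have hx' : P.ψ k x = 1 := hx
    simp [hx']
  intro x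
  obtain ⟨N, hN⟩ := pow_unbounded_of_one_lt ‖x‖ one_lt_two
  refine ⟨Metric.ball 0 (2 ^ N), Metric.isOpen_ball.mem_nhds (by simpa using hN), ?_⟩
  have hcover : IntegrableOn u (⋃ k ∈ Finset.range (N + 1), {x | P.ψ k x = 1}) :=
    integrableOn_finset_iUnion.2 fun k _ => hone k
  refine hcover.mono_set fun y hy => ?_
  obtain ⟨k, hk, hk1⟩ := P.exists_eq_one (N := N) (x := y)
    (by simpa using (mem_ball_zero_iff.1 hy).le)
  simp only [mem_iUnion, Finset.mem_range]
  exact ⟨k, by omega, hk1⟩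

end DyadicPartition

/-! ### Summation over the dyadic scales -/

/-- The weight `2^{(3/2+δ)2j}` of the `j`-th dyadic block. -/
def dyadicWeight (δ : ℝ) (j : ℕ) : ℝ≥0∞ := ENNReal.ofReal ((2 : ℝ) ^ ((3 + 2 * δ) * (j : ℝ)))

lemma HwNormSq_eq (P : DyadicPartition) (s δ : ℝ) (u : E3 → ℝ) :
    HwNormSq P s δ u = ∑' j, dyadicWeight δ j * HsNormSq s (P.block u j) := rfl

lemma dyadicWeight_ne_zero (δ : ℝ) (j : ℕ) : dyadicWeight δ j ≠ 0 := by
  rw [dyadicWeight, ne_eq, ENNReal.ofReal_eq_zero, not_le]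
  positivity

lemma dyadicWeight_le_pow {δ δ' : ℝ} {m : ℕ} (h : 3 + 2 * δ' ≤ m * (3 + 2 * δ)) (j : ℕ) :
    dyadicWeight δ' j ≤ dyadicWeight δ j ^ m := by
  rw [dyadicWeight, dyadicWeight, ← ENNReal.ofReal_pow (by positivity), ← Real.rpow_natCast,
    ← Real.rpow_mul (by norm_num)]
  refine ENNReal.ofReal_le_ofReal (Real.rpow_le_rpow_of_exponent_le one_le_two ?_)
  nlinarith [mul_le_mul_of_nonneg_right h (Nat.cast_nonneg (α := ℝ) j)]

lemma dyadicWeight_le_mul (δ : ℝ) {j k : ℕ} (h : |(j : ℝ) - k| ≤ 1) :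
    dyadicWeight δ j ≤ ENNReal.ofReal ((2 : ℝ) ^ |3 + 2 * δ|) * dyadicWeight δ k := by
  rw [dyadicWeight, dyadicWeight, ← ENNReal.ofReal_mul (by positivity),
    ← Real.rpow_add (by norm_num)]
  refine ENNReal.ofReal_le_ofReal (Real.rpow_le_rpow_of_exponent_le one_le_two ?_)
  have h1 : (3 + 2 * δ) * ((j : ℝ) - k) ≤ |3 + 2 * δ| := by
    refine (le_abs_self _).trans ?_
    rw [abs_mul]
    exact mul_le_of_le_one_right (abs_nonneg _) h
  linarith

lemma tsum_pow_neighbours_le (A : ℕ → ℝ≥0∞) (n : ℕ) :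
    ∑' j, (A (j - 1) + A j + A (j + 1)) ^ (n + 1) ≤ (4 * ∑' j, A j) ^ (n + 1) := by
  set T := ∑' j, A j
  have hle : ∀ j, A j ≤ T := ENNReal.le_tsum
  have hpred : ∑' j, A (j - 1) ≤ 2 * T := by
    rw [tsum_eq_zero_add' ENNReal.summable, two_mul]
    exact add_le_add (hle _) (by simp [T])
  have hsucc : ∑' j, A (j + 1) ≤ T :=
    ENNReal.tsum_comp_le_tsum_of_injective (add_left_injective 1) A
  have hS : ∀ j, A (j - 1) + A j + A (j + 1) ≤ 4 * T := fun j => by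
    calc A (j - 1) + A j + A (j + 1) ≤ T + T + T := by gcongr <;> exact hle _
      _ = 3 * T := by ring
      _ ≤ 4 * T := by gcongr; norm_num
  calc ∑' j, (A (j - 1) + A j + A (j + 1)) ^ (n + 1)
      ≤ ∑' j, (4 * T) ^ n * (A (j - 1) + A j + A (j + 1)) := by
        refine ENNReal.tsum_le_tsum fun j => ?_
        rw [pow_succ]
        gcongr
        exact hS j
    _ = (4 * T) ^ n * (∑' j, A (j - 1) + T + ∑' j, A (j + 1)) := by
        rw [ENNReal.tsum_mul_left, ENNReal.tsum_add, ENNReal.tsum_add]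
    _ ≤ (4 * T) ^ n * (2 * T + T + T) := by gcongr
    _ = _ := by ring

lemma MemH.memHs_block {P : DyadicPartition} {s δ : ℝ} {u : E3 → ℝ} (hu : MemH P s δ u)
    (j : ℕ) : MemHs s (P.block u j) := by
  refine ⟨P.integrable_block hu.1 j, ?_⟩
  have h : dyadicWeight δ j * HsNormSq s (P.block u j) < ⊤ :=
    (ENNReal.le_tsum j).trans_lt ((HwNormSq_eq P s δ u).symm.trans_lt hu.2)
  exact ENNReal.lt_top_of_mul_ne_top_right h.ne (dyadicWeight_ne_zero δ j)

/-- The power estimate for squared norms. -/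
lemma exists_HwNormSq_pow_le (P : DyadicPartition) {s δ δ' : ℝ} (n : ℕ) (hs : 3 / 2 < s)
    (h : 3 + 2 * δ' ≤ ((n + 1 : ℕ) : ℝ) * (3 + 2 * δ)) :
    ∃ R : ℝ≥0∞, R < ⊤ ∧ ∀ u : E3 → ℝ, MemH P s δ u →
      LocallyIntegrable (fun x => u x ^ (n + 1)) volume ∧
      HwNormSq P s δ' (fun x => u x ^ (n + 1)) ≤ R * HwNormSq P s δ u ^ (n + 1) := by
  obtain ⟨R, hR, hblock⟩ := P.exists_block_pow_bound hs n
  set e : ℝ≥0∞ := ENNReal.ofReal ((2 : ℝ) ^ |3 + 2 * δ|)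
  refine ⟨R * (e * 4) ^ (n + 1), ENNReal.mul_lt_top hR (ENNReal.pow_lt_top
    (ENNReal.mul_lt_top ENNReal.ofReal_lt_top (by simp))), fun u hu => ?_⟩
  have hb := hblock u hu.memHs_block
  refine ⟨P.locallyIntegrable_of_block fun j => (hb j).1.integrable, ?_⟩
  set N : ℕ → ℝ≥0∞ := fun j => HsNormSq s (P.block u j)
  set A : ℕ → ℝ≥0∞ := fun j => dyadicWeight δ j * N j with hA
  have hshift : ∀ j k : ℕ, |(j : ℝ) - k| ≤ 1 → dyadicWeight δ j * N k ≤ e * A k :=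
      fun j k hjk => by
    rw [hA, ← mul_assoc]
    gcongr
    exact dyadicWeight_le_mul δ hjk
  have hterm : ∀ j, dyadicWeight δ' j * HsNormSq s (P.block (fun x => u x ^ (n + 1)) j) ≤
      R * e ^ (n + 1) * (A (j - 1) + A j + A (j + 1)) ^ (n + 1) := fun j => by
    have hpred : |(j : ℝ) - (j - 1 : ℕ)| ≤ 1 := by
      rcases Nat.eq_zero_or_pos j with rfl | hj
      · simp
      · simp [Nat.cast_sub (Nat.one_le_iff_ne_zero.2 hj.ne')]
    calc dyadicWeight δ' j * HsNormSq s (P.block (fun x => u x ^ (n + 1)) j)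
        ≤ dyadicWeight δ j ^ (n + 1) * (R * (N (j - 1) + N j + N (j + 1)) ^ (n + 1)) := by
          gcongr
          · exact dyadicWeight_le_pow h j
          · exact (hb j).2
      _ = R * (dyadicWeight δ j * N (j - 1) + dyadicWeight δ j * N j +
            dyadicWeight δ j * N (j + 1)) ^ (n + 1) := by
          rw [← mul_add, ← mul_add, mul_pow]
          ring
      _ ≤ R * (e * A (j - 1) + e * A j + e * A (j + 1)) ^ (n + 1) := by
          exact mul_le_mul_right (pow_le_pow_left' (add_le_add (add_le_add
            (hshift j (j - 1) hpred) (hshift j j (by simp))) (hshift j (j + 1) (by simp))) _) R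
      _ = _ := by
          rw [← mul_add, ← mul_add, mul_pow, mul_assoc]
  calc HwNormSq P s δ' (fun x => u x ^ (n + 1))
      ≤ ∑' j, R * e ^ (n + 1) * (A (j - 1) + A j + A (j + 1)) ^ (n + 1) :=
        (HwNormSq_eq P s δ' _).trans_le (ENNReal.tsum_le_tsum hterm)
    _ ≤ R * e ^ (n + 1) * (4 * ∑' j, A j) ^ (n + 1) := by
        rw [ENNReal.tsum_mul_left]
        gcongr
        exact tsum_pow_neighbours_le A n
    _ = R * (e * 4) ^ (n + 1) * HwNormSq P s δ u ^ (n + 1) := by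
        rw [HwNormSq_eq, mul_pow, mul_pow]
        ring

/-- Corollary: powers of functions.
If `s > 3/2`, `m ≥ 2` and `δ₀/(m-1) - 3/2 ≤ δ`, then there is a constant `C`,
independent of `u`, such that for every `u ∈ H_{s,δ}` the power `u^m` belongs to
`H_{s,δ+δ₀}` with `‖u^m‖_{H_{s,δ+δ₀}} ≤ C ‖u‖_{H_{s,δ}}^m`. -/
theorem power_estimate_int (P : DyadicPartition) (s δ δ₀ : ℝ) (m : ℕ) (hm : 2 ≤ m)
    (hs : 3/2 < s) (hδ : δ₀ / ((m : ℝ) - 1) - 3/2 ≤ δ) :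
    ∃ C : ℝ, 0 < C ∧ ∀ u : E3 → ℝ, MemH P s δ u →
      MemH P s (δ + δ₀) (fun x => u x ^ m) ∧
      Hnorm P s (δ + δ₀) (fun x => u x ^ m) ≤ C * Hnorm P s δ u ^ m := by
  obtain ⟨n, rfl⟩ : ∃ n, m = n + 1 := ⟨m - 1, by omega⟩
  have hn : (0 : ℝ) < n := by exact_mod_cast (by omega : 0 < n)
  have hexp : 3 + 2 * (δ + δ₀) ≤ ((n + 1 : ℕ) : ℝ) * (3 + 2 * δ) := by
    push_cast at hδ ⊢
    rw [add_sub_cancel_right, sub_le_iff_le_add, div_le_iff₀ hn] at hδ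
    linarith
  obtain ⟨R, hR, hbound⟩ := exists_HwNormSq_pow_le P n hs hexp
  refine ⟨√R.toReal + 1, by positivity, fun u hu => ?_⟩
  obtain ⟨hloc, hle⟩ := hbound u hu
  have htop : R * HwNormSq P s δ u ^ (n + 1) < ⊤ :=
    ENNReal.mul_lt_top hR (ENNReal.pow_lt_top hu.2)
  refine ⟨⟨hloc, hle.trans_lt htop⟩, ?_⟩
  calc Hnorm P s (δ + δ₀) (fun x => u x ^ (n + 1))
      ≤ √(R * HwNormSq P s δ u ^ (n + 1)).toReal :=
        Real.sqrt_le_sqrt (ENNReal.toReal_mono htop.ne hle)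
    _ = √R.toReal * Hnorm P s δ u ^ (n + 1) := by
        rw [ENNReal.toReal_mul, ENNReal.toReal_pow, Real.sqrt_mul ENNReal.toReal_nonneg, Hnorm]
        congr 1
        rw [Real.sqrt_eq_iff_mul_self_eq (by positivity) (by positivity), ← mul_pow,
          Real.mul_self_sqrt ENNReal.toReal_nonneg]
    _ ≤ (√R.toReal + 1) * Hnorm P s δ u ^ (n + 1) := by
        have : 0 ≤ Hnorm P s δ u := Real.sqrt_nonneg _
        gcongr
        linarith
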